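/- Let H be a separable complex Hilbert space and let M be a von Neumann subalgebra of B(H), with ℓ : M → B(H) the inclusion map. If (M, ℓ) has the λ-Lindenstrauss–Pełczyński property for some λ ≥ 1, then there exists a positive integer n such that M satisfies the standard polynomial identity of degree 2n: for all x₁, …, x₂ₙ ∈ M, ∑_{σ ∈ Perm(Fin 2n)} sign(σ) · x_{σ(1)} x_{σ(2)} ⋯ x_{σ(2n)} = 0. -/

import Mathlib

set_option synthInstance.maxHeartbeats 1000000
set_option maxHeartbeats 1000000

/-- `E` is an `L∞,λ`-space. -/
def IsLinftySpace (E : Type*) [NormedAddCommGroup E] [NormedSpace ℂ E] (lam : ℝ) : Prop :=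
  (¬ FiniteDimensional ℂ E) ∧
  ∀ F : Subspace ℂ E, FiniteDimensional ℂ F →
    ∃ G : Subspace ℂ E, F ≤ G ∧ FiniteDimensional ℂ G ∧
      ∃ T : G ≃L[ℂ] (Fin (Module.finrank ℂ G) → ℂ),
        ‖(T : G →L[ℂ] (Fin (Module.finrank ℂ G) → ℂ))‖ *
          ‖(T.symm : (Fin (Module.finrank ℂ G) → ℂ) →L[ℂ] G)‖ ≤ lam

/-- `(M, ℓ)` has the `λ`-Lindenstrauss–Pełczyński property. -/
def HasLPProperty {M Z : Type*} [NormedAddCommGroup M] [NormedSpace ℂ M]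
    [NormedAddCommGroup Z] [NormedSpace ℂ Z] (lam : ℝ) (ℓ : M →L[ℂ] Z) : Prop :=
  ∃ (E : Type) (_ : NormedAddCommGroup E) (_ : NormedSpace ℂ E),
    IsLinftySpace E lam ∧ ∃ (S : M →L[ℂ] E) (T : E →L[ℂ] Z), T.comp S = ℓ


theorem std_matrix {A : Type*} [CommRing A] (m k : ℕ) (hk : m * m < k)
    (X : Fin k → Matrix (Fin m) (Fin m) A) :
    ∑ σ : Equiv.Perm (Fin k), (Equiv.Perm.sign σ : ℤ) • (List.ofFn fun i => X (σ i)).prod = 0 := by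
  have h0 : MultilinearMap.alternatization
      (MultilinearMap.mkPiAlgebraFin A k (Matrix (Fin m) (Fin m) A)) = 0 := by
    refine Module.Basis.ext_alternating (Matrix.stdBasis A (Fin m) (Fin m)) fun v hv => ?_
    have := Fintype.card_le_of_injective v hv
    simp at this
    omega
  have h1 := congrArg (fun f => f X) h0
  simp only [MultilinearMap.alternatization_apply, MultilinearMap.domDomCongr_apply,
    MultilinearMap.mkPiAlgebraFin_apply, AlternatingMap.zero_apply] at h1
  exact h1

theorem std_abs {A R : Type*} [CommRing A] [Ring R] (φ : A →+* R) {m k : ℕ} (hk : m * m < k)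
    (v : Fin m → R) (x : Fin k → R) (X : Fin k → Matrix (Fin m) (Fin m) A)
    (h : ∀ t i, v i * x t = ∑ j, φ (X t i j) * v j) (i : Fin m) :
    v i * (∑ σ : Equiv.Perm (Fin k), (Equiv.Perm.sign σ : ℤ) •
      (List.ofFn fun i => x (σ i)).prod) = 0 := by
  have key : ∀ (l : List (Fin k)) (i : Fin m),
      v i * (l.map x).prod = ∑ j, φ ((l.map X).prod i j) * v j := by
    intro l
    induction l with
    | nil => intro i; simp [Matrix.one_apply]
    | cons t l ih =>
      intro i
      simp only [List.map_cons, List.prod_cons]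
      rw [← mul_assoc, h, Finset.sum_mul]
      simp only [mul_assoc, ih, Matrix.mul_apply, map_sum, map_mul, Finset.mul_sum, Finset.sum_mul]
      rw [Finset.sum_comm]
  have h2 := std_matrix m k hk X
  have e1 : ∀ σ : Equiv.Perm (Fin k), (List.ofFn fun i => x (σ i)) = (List.ofFn σ).map x := by
    intro σ; rw [List.map_ofFn]; rfl
  have e2 : ∀ σ : Equiv.Perm (Fin k), (List.ofFn fun i => X (σ i)) = (List.ofFn σ).map X := by
    intro σ; rw [List.map_ofFn]; rfl
  simp only [e2] at h2
  simp only [e1, Finset.mul_sum, mul_smul_comm, key, Finset.smul_sum]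
  rw [Finset.sum_comm]
  refine Finset.sum_eq_zero fun j _ => ?_
  have h3 := congrArg (fun Y : Matrix (Fin m) (Fin m) A => φ (Y i j) * v j) h2
  simp only [Matrix.sum_apply, Matrix.smul_apply, map_sum, map_zsmul, Finset.sum_mul,
    smul_mul_assoc, Matrix.zero_apply, map_zero, zero_mul] at h3
  exact h3

section VN
variable {H : Type} [NormedAddCommGroup H] [InnerProductSpace ℂ H] [CompleteSpace H]

theorem vn_mem_of_comm (M : VonNeumannAlgebra H) (x : H →L[ℂ] H)
    (h : ∀ y ∈ M.commutant, y * x = x * y) : x ∈ M := by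
  rw [← M.commutant_commutant, VonNeumannAlgebra.mem_commutant_iff]
  exact h

theorem vn_smul_mem (M : VonNeumannAlgebra H) (c : ℂ) {x : H →L[ℂ] H} (hx : x ∈ M) : c • x ∈ M :=
  M.toStarSubalgebra.smul_mem hx c

theorem vn_spectral (M : VonNeumannAlgebra H) {a : H →L[ℂ] H} (haM : a ∈ M) (ha : 0 ≤ a)
    (hne : a ≠ 0) {ε : ℝ} (hε : 0 < ε) :
    ∃ e ∈ M, ∃ k ∈ M, star e = e ∧ e * e = e ∧ e ≠ 0 ∧ star k = k ∧
      k * a * k * e = e ∧ a * (k * k * e) = e ∧ ‖a * e - (‖a‖ : ℂ) • e‖ ≤ ε := by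
  have hnt : Nontrivial (H →L[ℂ] H) := ⟨a, 0, hne⟩
  have hna : 0 < ‖a‖ := norm_pos_iff.2 hne
  have hsa : IsSelfAdjoint a := IsSelfAdjoint.of_nonneg ha
  obtain ⟨δ, hδ0, hδε, hδa⟩ : ∃ δ : ℝ, 0 < δ ∧ δ ≤ ε ∧ δ < ‖a‖ :=
    ⟨min ε (‖a‖/2), by positivity, min_le_left _ _, (min_le_right _ _).trans_lt (by linarith)⟩
  let g : ℝ → ℝ := fun t => max 0 (min 1 ((t - (‖a‖ - δ)) / (δ/2)))
  let kf : ℝ → ℝ := fun t => Real.sqrt (g t / max t (‖a‖ - δ))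
  let h : ℝ → ℝ := fun t => max 0 (t - (‖a‖ - δ/2))
  have hg : Continuous g := by fun_prop
  have hkf : Continuous kf := by
    refine Real.continuous_sqrt.comp (hg.div (by fun_prop) fun t => ?_)
    have := le_max_right t (‖a‖ - δ)
    linarith
  have hh : Continuous h := by fun_prop
  have hg0 : ∀ t, 0 ≤ g t := fun t => le_max_left _ _
  have hg1 : ∀ t, g t ≤ 1 := fun t => max_le zero_le_one (min_le_left _ _)
  have hglow : ∀ t, t ≤ ‖a‖ - δ → g t = 0 := by
    intro t ht
    apply max_eq_left
    refine (min_le_right _ _).trans ?_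
    apply div_nonpos_of_nonpos_of_nonneg <;> linarith
  have hghigh : ∀ t, ‖a‖ - δ/2 ≤ t → g t = 1 := by
    intro t ht
    have : 1 ≤ ((t - (‖a‖ - δ)) / (δ/2)) := by
      rw [le_div_iff₀ (by positivity)]; linarith
    simp only [g]
    rw [min_eq_left this]; simp
  have hk2 : ∀ t, kf t * kf t * t = g t := by
    intro t
    have hp : 0 < max t (‖a‖ - δ) := lt_of_lt_of_le (by linarith) (le_max_right _ _)
    simp only [kf]
    rw [Real.mul_self_sqrt (div_nonneg (hg0 t) hp.le)]
    rcases le_total t (‖a‖ - δ) with ht | ht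
    · rw [hglow t ht]; simp
    · rw [max_eq_left ht] at hp ⊢
      field_simp
  have hgh : ∀ t, g t * h t = h t := by
    intro t
    rcases le_total t (‖a‖ - δ/2) with ht | ht
    · have : h t = 0 := max_eq_left (by linarith)
      rw [this]; simp
    · rw [hghigh t ht, one_mul]
  set G := cfc g a with hG
  set k := cfc kf a with hk
  set D := cfc h a with hD
  have hDne : D ≠ 0 := by
    intro h0
    have h1 := norm_apply_le_norm_cfc h a (CStarAlgebra.norm_mem_spectrum_of_nonneg ha)
      hh.continuousOn hsa
    rw [← hD, h0, norm_zero] at h1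
    have h2 : h ‖a‖ = δ/2 := by
      simp only [h]; rw [max_eq_right] <;> linarith
    rw [h2, Real.norm_eq_abs, abs_of_pos (by positivity)] at h1
    linarith
  have hGD : G * D = D := by
    rw [hG, hD, ← cfc_mul g h a hg.continuousOn hh.continuousOn]
    congr 1; funext t; exact hgh t
  have hka : k * a = a * k := ((Commute.refl a).cfc_real kf).eq
  have hkak : k * a * k = G := by
    rw [mul_assoc, ← hka, ← mul_assoc]
    conv_lhs => rw [hk, ← cfc_mul kf kf a hkf.continuousOn hkf.continuousOn]
    conv_lhs => rw [show a = cfc (id : ℝ → ℝ) a from (cfc_id ℝ a hsa).symm]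
    rw [cfc_id ℝ a hsa]
    nth_rewrite 2 [← cfc_id ℝ a hsa]
    rw [← cfc_mul _ _ a (by fun_prop) (by fun_prop)]
    rw [hG]; congr 1; funext t; exact hk2 t
  have hGs : star G = G := (cfc_predicate g a : IsSelfAdjoint _)
  have hks : star k = k := (cfc_predicate kf a : IsSelfAdjoint _)
  let K : Submodule ℂ H := (1 - G : H →L[ℂ] H).ker
  have hKc : IsClosed (K : Set H) := (1 - G : H →L[ℂ] H).isClosed_ker
  have : CompleteSpace K := hKc.completeSpace_coe
  have hmemK : ∀ x, x ∈ K ↔ G x = x := by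
    intro x
    simp only [K, LinearMap.mem_ker]
    change x - G x = 0 ↔ _
    rw [sub_eq_zero, eq_comm]
  have hkM : k ∈ M := by
    apply vn_mem_of_comm
    intro y hy
    rw [VonNeumannAlgebra.mem_commutant_iff] at hy
    exact (((show Commute a y from hy a haM)).cfc_real kf).eq.symm
  have hp : IsStarProjection K.starProjection := isStarProjection_starProjection
  have hGe : G * K.starProjection = K.starProjection := by
    ext x
    exact (hmemK _).1 (K.starProjection_apply_mem x)
  refine ⟨K.starProjection, ?_, k, hkM, hp.isSelfAdjoint, hp.isIdempotentElem, ?_, hks, ?_, ?_, ?_⟩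
  · rw [VonNeumannAlgebra.IsStarProjection.mem_iff hp]
    intro y hy
    rw [VonNeumannAlgebra.mem_commutant_iff] at hy
    have hc : G * y = y * G := (((show Commute a y from hy a haM)).cfc_real g).eq
    rw [Submodule.range_starProjection]
    intro x hx
    rw [Submodule.mem_comap, hmemK]
    rw [hmemK] at hx
    have := congrArg (fun z : H →L[ℂ] H => z x) hc
    simp only [mul_apply_eq_comp] at this
    rw [hx] at this
    exact this
  · intro h0
    apply hDne
    ext x
    have hx : D x ∈ K := by
      rw [hmemK]
      exact congrArg (fun z : H →L[ℂ] H => z x) hGD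
    have := Submodule.starProjection_eq_self_iff.2 hx
    rw [h0] at this
    simpa using this.symm
  · rw [hkak, hGe]
  · rw [← mul_assoc, ← mul_assoc, ← hka, hkak, hGe]
  · have e1 : a * K.starProjection - (‖a‖ : ℂ) • K.starProjection
        = cfc (fun t => (t - ‖a‖) * g t) a * K.starProjection := by
      rw [cfc_mul (fun t => t - ‖a‖) g a (by fun_prop) (by fun_prop), mul_assoc, ← hG, hGe,
        cfc_sub (fun t => t) (fun _ => ‖a‖) a (by fun_prop) (by fun_prop), sub_mul, cfc_id' ℝ a hsa,
        cfc_const _ a hsa]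
      rw [Algebra.algebraMap_eq_smul_one, smul_mul_assoc, one_mul]
      rfl
    rw [e1]
    refine (norm_mul_le _ _).trans ?_
    have n1 : ‖cfc (fun t => (t - ‖a‖) * g t) a‖ ≤ ε := by
      refine norm_cfc_le hε.le fun t ht => ?_
      have ht1 : t ≤ ‖a‖ := (le_abs_self t).trans (spectrum.norm_le_norm_of_mem ht)
      rcases le_total t (‖a‖ - δ) with h1 | h1
      · rw [hglow t h1]; simp [hε.le]
      · rw [norm_mul]
        have : ‖t - ‖a‖‖ ≤ ε := by
          rw [Real.norm_eq_abs, abs_le]; constructor <;> linarith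
        have h2 : ‖g t‖ ≤ 1 := by
          rw [Real.norm_eq_abs, abs_of_nonneg (hg0 t)]; exact hg1 t
        nlinarith [norm_nonneg (t - ‖a‖), norm_nonneg (g t)]
    have n2 : ‖K.starProjection‖ ≤ 1 := K.starProjection_norm_le
    nlinarith [norm_nonneg (K.starProjection), norm_nonneg (cfc (fun t => (t - ‖a‖) * g t) a)]

structure IsVNChain (M : VonNeumannAlgebra H) (e : H →L[ℂ] H) {m : ℕ}
    (v : Fin m → (H →L[ℂ] H)) : Prop where
  mem : e ∈ M
  sa : star e = e
  idem : e * e = e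
  ne : e ≠ 0
  vmem : ∀ i, v i ∈ M
  ev : ∀ i, e * v i = v i
  orth : ∀ i j, v i * star (v j) = if i = j then e else 0

theorem IsVNChain.extend {M : VonNeumannAlgebra H} {e : H →L[ℂ] H} {m : ℕ}
    {v : Fin m → (H →L[ℂ] H)} (hc : IsVNChain M e v) {w : H →L[ℂ] H} (hw : w ∈ M) (hw0 : w ≠ 0)
    (hew : e * w = w) (hwv : ∀ j, w * star (v j) * (w * star w) = 0) :
    ∃ (q : H →L[ℂ] H) (v' : Fin (m+1) → (H →L[ℂ] H)), IsVNChain M q v' ∧ e * q = q := by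
  have ha0 : w * star w ≠ 0 := by
    intro h
    exact hw0 (CStarRing.mul_star_self_eq_zero_iff w |>.1 h)
  obtain ⟨q, hqM, k, hkM, hqs, hqq, hq0, hks, h1, h2, -⟩ :=
    vn_spectral M (mul_mem hw (star_mem hw)) (mul_star_self_nonneg w) ha0 one_pos
  have heq : e * q = q := by
    rw [← h2]
    simp only [← mul_assoc, hew]
  have hqe : q * e = q := by
    have := congrArg star heq
    rwa [star_mul, hqs, hc.sa] at this
  have huv : ∀ j, (q * k * w) * star (q * v j) = 0 := by
    intro j
    have : (q * k * w) * star (q * v j) = q * k * (w * star (v j) * q) := by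
      rw [star_mul, hqs]; simp only [mul_assoc]
    rw [this]
    have : w * star (v j) * q = 0 := by
      conv_lhs => rw [← h2]
      rw [← mul_assoc, hwv j, zero_mul]
    rw [this, mul_zero]
  refine ⟨q, Fin.cons (q * k * w) (fun i => q * v i), ⟨hqM, hqs, hqq, hq0, ?_, ?_, ?_⟩, heq⟩
  · intro i
    refine Fin.cases ?_ (fun i => ?_) i
    · exact mul_mem (mul_mem hqM hkM) hw
    · exact mul_mem hqM (hc.vmem i)
  · intro i
    refine Fin.cases ?_ (fun i => ?_) i
    · simp only [Fin.cons_zero, ← mul_assoc, hqq]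
    · simp only [Fin.cons_succ, ← mul_assoc, hqq]
  · intro i j
    refine Fin.cases ?_ (fun i => ?_) i <;> refine Fin.cases ?_ (fun j => ?_) j
    · simp only [Fin.cons_zero, if_true]
      rw [star_mul, star_mul, hqs, hks]
      have : q * k * w * (star w * (k * q)) = q * (k * (w * star w) * k * q) := by
        simp only [mul_assoc]
      rw [this, h1, hqq]
    · simp only [Fin.cons_zero, Fin.cons_succ]
      rw [huv j, if_neg (Fin.succ_ne_zero j).symm]
    · simp only [Fin.cons_zero, Fin.cons_succ]
      rw [if_neg (Fin.succ_ne_zero i)]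
      have := congrArg star (huv i)
      rwa [star_mul, star_star, star_zero] at this
    · simp only [Fin.cons_succ, Fin.succ_inj]
      have : q * v i * star (q * v j) = q * (v i * star (v j)) * q := by
        rw [star_mul, hqs]; simp only [mul_assoc]
      rw [this, hc.orth]
      split_ifs
      · rw [hqe, hqq]
      · simp

theorem proj_norm_one {q : H →L[ℂ] H} (hs : star q = q) (hq : q * q = q) (h0 : q ≠ 0) :
    ‖q‖ = 1 := by
  have h := CStarRing.norm_star_mul_self (x := q)
  rw [hs, hq] at h
  have : 0 < ‖q‖ := norm_pos_iff.2 h0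
  nlinarith

theorem corner_proj_central (M : VonNeumannAlgebra H) {e : H →L[ℂ] H}
    (heM : e ∈ M) (hes : star e = e) (hee : e * e = e)
    (hnil : ∀ x ∈ M, e * x = x → x * e = x → x * x = 0 → x = 0)
    {q : H →L[ℂ] H} (hqM : q ∈ M) (hqs : star q = q) (hqq : q * q = q) (heq : e * q = q)
    {x : H →L[ℂ] H} (hx : x ∈ M) (hex : e * x = x) (hxe : x * e = x) : q * x = x * q := by
  have hqe : q * e = q := by
    have := congrArg star heq
    rwa [star_mul, hqs, hes] at this
  have z1 : (e - q) * q = 0 := by rw [sub_mul, heq, hqq, sub_self]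
  have z2 : q * (e - q) = 0 := by rw [mul_sub, hqe, hqq, sub_self]
  have a1 : q * x * (e - q) = 0 := by
    apply hnil
    · exact mul_mem (mul_mem hqM hx) (sub_mem heM hqM)
    · simp only [← mul_assoc, heq]
    · simp only [mul_assoc, sub_mul, hee, hqe]
    · have : q * x * (e - q) * (q * x * (e - q)) = q * x * ((e - q) * q) * x * (e - q) := by
        simp only [mul_assoc]
      rw [this, z1]; simp
  have a2 : (e - q) * x * q = 0 := by
    apply hnil
    · exact mul_mem (mul_mem (sub_mem heM hqM) hx) hqM
    · simp only [← mul_assoc, mul_sub, hee, heq]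
    · simp only [mul_assoc, hqe]
    · have : (e - q) * x * q * ((e - q) * x * q) = (e - q) * x * (q * (e - q)) * x * q := by
        simp only [mul_assoc]
      rw [this, z2]; simp
  rw [mul_sub, mul_assoc, hxe, sub_eq_zero] at a1
  rw [sub_mul, hex, sub_mul, sub_eq_zero] at a2
  rw [a1, a2]

theorem corner_comm_aux (M : VonNeumannAlgebra H) {e : H →L[ℂ] H}
    (heM : e ∈ M) (hes : star e = e) (hee : e * e = e)
    (hnil : ∀ x ∈ M, e * x = x → x * e = x → x * x = 0 → x = 0)
    {y : H →L[ℂ] H} (hy : y ∈ M) (hey : e * y = y) (hye : y * e = y)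
    {b : H →L[ℂ] H} (hb : b ∈ M) (heb : e * b = b) (hbe : b * e = b) :
    (star y * y) * b = b * (star y * y) := by
  have hcen := fun {q} => @corner_proj_central _ _ _ _ M e heM hes hee hnil q
  have heys : e * star y = star y := by
    have := congrArg star hye
    rwa [star_mul, hes] at this
  set a := star y * y with ha
  have haM : a ∈ M := mul_mem (star_mem hy) hy
  have hea : e * a = a := by rw [ha, ← mul_assoc, heys]
  have hae : a * e = a := by rw [ha, mul_assoc, hye]
  by_contra hne
  set c := a * b - b * a with hcdef
  have hc0 : c ≠ 0 := sub_ne_zero.2 hne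
  have hcM : c ∈ M := sub_mem (mul_mem haM hb) (mul_mem hb haM)
  have hce : c * e = c := by rw [hcdef, sub_mul, mul_assoc a b e, mul_assoc b a e, hbe, hae]
  have hecs : e * star c = star c := by
    have := congrArg star hce
    rwa [star_mul, hes] at this
  set d := star c * c with hd
  have hd0 : d ≠ 0 := fun h => hc0 (CStarRing.star_mul_self_eq_zero_iff c |>.1 h)
  have hdn : 0 < ‖d‖ := norm_pos_iff.2 hd0
  obtain ⟨p, hpM, k, hkM, hps, hpp, hp0, hks, h1, h2, h3⟩ :=
    vn_spectral M (mul_mem (star_mem hcM) hcM) (star_mul_self_nonneg c) hd0 (half_pos hdn)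
  rw [← hd] at h2 h3
  have hep : e * p = p := by
    rw [← h2, hd]; simp only [← mul_assoc, hecs]
  have key : ∀ ε : ℝ, 0 < ε → ∃ q ∈ M, ∃ s : ℂ, star q = q ∧ q * q = q ∧ q ≠ 0 ∧ p * q = q ∧
      ‖a * q - s • q‖ ≤ ε := by
    intro ε hε
    have hpa : p * a = a * p := hcen hpM hps hpp hep haM hea hae
    have hap : star (y * p) * (y * p) = a * p := by
      rw [star_mul, hps, ← mul_assoc, mul_assoc p, ← ha, hpa, mul_assoc, hpp]
    by_cases h0 : a * p = 0
    · exact ⟨p, hpM, 0, hps, hpp, hp0, hpp, by rw [h0]; simp [hε.le]⟩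
    · obtain ⟨q, hqM, k', -, hqs, hqq, hq0, -, -, h2', h3'⟩ :=
        vn_spectral M (mul_mem haM hpM) (by rw [← hap]; exact star_mul_self_nonneg _) h0 hε
      have hpq : p * q = q := by
        rw [← h2', ← hpa]; simp only [← mul_assoc, hpp]
      refine ⟨q, hqM, (‖a * p‖ : ℂ), hqs, hqq, hq0, hpq, ?_⟩
      · rw [mul_assoc, hpq] at h3'
        exact h3'
  have hpos : 0 < ‖d‖ / (8 * (‖c‖ * ‖b‖ + 1)) := by positivity
  obtain ⟨q, hqM, s, hqs, hqq, hq0, hpq, hq⟩ := key _ hpos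
  have heq : e * q = q := by rw [← hpq, ← mul_assoc, hep]
  have hqb : q * b = b * q := hcen hqM hqs hqq heq hb heb hbe
  have hcq : c * q = (a * q - s • q) * b - b * (a * q - s • q) := by
    rw [hcdef]
    simp only [sub_mul, mul_sub, smul_mul_assoc, mul_smul_comm, mul_assoc, hqb]
    abel
  have hq1 := proj_norm_one hqs hqq hq0
  set r := a * q - s • q
  have n1 : ‖c * q‖ ≤ 2 * ‖r‖ * ‖b‖ := by
    rw [hcq]
    refine (norm_sub_le _ _).trans ?_
    have := norm_mul_le r b
    have := norm_mul_le b r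
    linarith
  have n2 : ‖d * q‖ ≤ ‖c‖ * (2 * ‖r‖ * ‖b‖) := by
    rw [hd, mul_assoc]
    refine (norm_mul_le _ _).trans ?_
    rw [norm_star]
    gcongr
  have n3 : ‖d * q - (‖d‖ : ℂ) • q‖ ≤ ‖d‖ / 2 := by
    have : d * q - (‖d‖ : ℂ) • q = (d * p - (‖d‖ : ℂ) • p) * q := by
      rw [sub_mul, mul_assoc d p q, hpq, smul_mul_assoc, hpq]
    rw [this]
    refine (norm_mul_le _ _).trans ?_
    rw [hq1, mul_one]; exact h3
  have n4 : ‖(‖d‖ : ℂ) • q‖ = ‖d‖ := by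
    rw [norm_smul, hq1]; simp
  have n5 := norm_sub_norm_le ((‖d‖ : ℂ) • q) (d * q)
  rw [n4, norm_sub_rev] at n5
  have n6 : ‖c‖ * (2 * ‖r‖ * ‖b‖) ≤ ‖d‖ / 4 := by
    have : ‖r‖ * (8 * (‖c‖ * ‖b‖ + 1)) ≤ ‖d‖ := by
      rwa [le_div_iff₀ (by positivity)] at hq
    nlinarith [norm_nonneg r]
  linarith

theorem corner_comm (M : VonNeumannAlgebra H) {e : H →L[ℂ] H}
    (heM : e ∈ M) (hes : star e = e) (hee : e * e = e)
    (hnil : ∀ x ∈ M, e * x = x → x * e = x → x * x = 0 → x = 0)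
    {y : H →L[ℂ] H} (hy : y ∈ M) (hey : e * y = y) (hye : y * e = y)
    {b : H →L[ℂ] H} (hb : b ∈ M) (heb : e * b = b) (hbe : b * e = b) :
    y * b = b * y := by
  have key : ∀ c : ℂ, (star (y + c • e) * (y + c • e)) * b = b * (star (y + c • e) * (y + c • e)) := by
    intro c
    refine corner_comm_aux M heM hes hee hnil (add_mem hy (vn_smul_mem M c heM)) ?_ ?_ hb heb hbe
    · rw [mul_add, hey, mul_smul_comm, hee]
    · rw [add_mul, hye, smul_mul_assoc, hee]
  have heys : e * star y = star y := by
    have := congrArg star hye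
    rwa [star_mul, hes] at this
  have hyse : star y * e = star y := by
    have := congrArg star hey
    rwa [star_mul, hes] at this
  have ex : ∀ c : ℂ, star (y + c • e) * (y + c • e)
      = star y * y + c • star y + star c • y + (star c * c) • e := by
    intro c
    simp only [star_add, star_smul, hes, add_mul, mul_add, smul_mul_assoc, mul_smul_comm, hee, hey,
      hyse, smul_smul, smul_add, mul_comm c (star c)]
    abel
  have k0 := key 0
  have k1 := key 1
  have k2 := key Complex.I
  rw [ex] at k0 k1 k2
  have hI : star Complex.I = -Complex.I := Complex.conj_I
  simp only [zero_smul, star_zero, star_one, one_smul, mul_one, add_zero, mul_zero, add_mul,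
    mul_add, heb, hbe, hI, neg_mul, Complex.I_mul_I, neg_neg, neg_smul, smul_mul_assoc,
    mul_smul_comm, mul_neg] at k0 k1 k2
  have e1 : (star y * b - b * star y) + (y * b - b * y) = 0 := by
    have := congrArg₂ (· - ·) k1 k0
    rw [← sub_eq_zero] at this
    refine Eq.trans ?_ this
    abel
  have e2 : (star y * b - b * star y) - (y * b - b * y) = 0 := by
    have : Complex.I • ((star y * b - b * star y) - (y * b - b * y)) = 0 := by
      have := congrArg₂ (· - ·) k2 k0
      rw [← sub_eq_zero] at this
      refine Eq.trans ?_ this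
      simp only [smul_sub]; abel
    exact (smul_eq_zero.1 this).resolve_left Complex.I_ne_zero
  have e3 : (2 : ℂ) • (y * b - b * y) = 0 := by
    have := congrArg₂ (· - ·) e1 e2
    simp only [sub_zero] at this
    rw [← this, two_smul]; abel
  exact sub_eq_zero.1 ((smul_eq_zero.1 e3).resolve_left two_ne_zero)

theorem vn_pi (M : VonNeumannAlgebra H) {N k : ℕ} (hN1 : 1 ≤ N)
    (hN : ∀ (e : H →L[ℂ] H) (v : Fin N → (H →L[ℂ] H)), ¬ IsVNChain M e v) (hk : N * N < k)
    (x : Fin k → (H →L[ℂ] H)) (hx : ∀ i, x i ∈ M) :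
    ∑ σ : Equiv.Perm (Fin k), (Equiv.Perm.sign σ : ℤ) • (List.ofFn fun i => x (σ i)).prod = 0 := by
  set y := ∑ σ : Equiv.Perm (Fin k), (Equiv.Perm.sign σ : ℤ) • (List.ofFn fun i => x (σ i)).prod
    with hy
  by_contra hy0
  have hyM : y ∈ M := by
    refine sum_mem fun σ _ => zsmul_mem (list_prod_mem ?_) _
    intro z hz
    rw [List.mem_ofFn] at hz
    obtain ⟨i, rfl⟩ := hz
    exact hx _
  have hyy : y * star y ≠ 0 := fun h => hy0 (CStarRing.mul_star_self_eq_zero_iff y |>.1 h)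
  obtain ⟨p, hpM, k', hkM, hps, hpp, hp0, hks, h1, h2, -⟩ :=
    vn_spectral M (mul_mem hyM (star_mem hyM)) (mul_star_self_nonneg y) hyy one_pos
  let P : ℕ → Prop := fun m => ∃ (q : H →L[ℂ] H) (v : Fin m → (H →L[ℂ] H)),
    IsVNChain M q v ∧ p * q = q
  have hP1 : P 1 := ⟨p, fun _ => p, ⟨hpM, hps, hpp, hp0, fun _ => hpM, fun _ => hpp, by
    intro i j; rw [hps, hpp, if_pos (Subsingleton.elim i j)]⟩, hpp⟩
  obtain ⟨m, hm1, hmN, ⟨e, v, hc, hpe⟩, hPm1⟩ : ∃ m, 1 ≤ m ∧ m ≤ N ∧ P m ∧ ¬ P (m+1) := by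
    by_contra hcon
    push Not at hcon
    have : ∀ m, 1 ≤ m → m ≤ N → P m := by
      intro m hm
      induction m, hm using Nat.le_induction with
      | base => intro _; exact hP1
      | succ m hm ih => intro hh; exact hcon m hm (by omega) (ih (by omega))
    obtain ⟨q, v, hc, -⟩ := this N hN1 le_rfl
    exact hN q v hc
  have hext : ∀ w ∈ M, e * w = w → (∀ j, w * star (v j) * (w * star w) = 0) → w = 0 := by
    intro w hw hew hwv
    by_contra hw0
    obtain ⟨q, v', hc', heq⟩ := hc.extend hw hw0 hew hwv
    exact hPm1 ⟨q, v', hc', by rw [← heq, ← mul_assoc, hpe]⟩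
  have hve : ∀ i, star (v i) * e = star (v i) := by
    intro i
    have := congrArg star (hc.ev i)
    rwa [star_mul, hc.sa] at this
  have hnil : ∀ z ∈ M, e * z = z → z * e = z → z * z = 0 → z = 0 := by
    intro z hz hez hze hzz
    have h00 : z * v ⟨0, hm1⟩ = 0 := by
      apply hext
      · exact mul_mem hz (hc.vmem _)
      · rw [← mul_assoc, hez]
      · intro j
        have : z * v ⟨0, hm1⟩ * star (v j) * (z * v ⟨0, hm1⟩ * star (z * v ⟨0, hm1⟩))
          = z * (v ⟨0, hm1⟩ * star (v j)) * z * v ⟨0, hm1⟩ * star (z * v ⟨0, hm1⟩) := by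
          simp only [mul_assoc]
        rw [this, hc.orth]
        split_ifs
        · rw [hze, hzz]; simp
        · simp
    have := congrArg (· * star (v ⟨0, hm1⟩)) h00
    simp only [mul_assoc, hc.orth, if_true, zero_mul, hze] at this
    exact this
  have hexp : ∀ w ∈ M, e * w = w → w = ∑ j, w * star (v j) * v j := by
    intro w hw hew
    rw [← sub_eq_zero]
    have hz : ∀ l, (w - ∑ j, w * star (v j) * v j) * star (v l) = 0 := by
      intro l
      rw [sub_mul, Finset.sum_mul]
      simp only [mul_assoc, hc.orth]
      simp [hve]
    apply hext
    · exact sub_mem hw (sum_mem fun j _ => mul_mem (mul_mem hw (star_mem (hc.vmem j))) (hc.vmem j))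
    · rw [mul_sub, Finset.mul_sum]
      simp only [← mul_assoc, hew]
    · intro j
      rw [hz, zero_mul]
  let Z : Set (H →L[ℂ] H) := {z | z ∈ M ∧ e * z = z ∧ z * e = z}
  have hZ : ∀ a ∈ Z, ∀ b ∈ Z, a * b = b * a := by
    rintro a ⟨ha, hea, hae⟩ b ⟨hb, heb, hbe⟩
    exact corner_comm M hc.mem hc.sa hc.idem hnil ha hea hae hb heb hbe
  let _ : CommRing (Algebra.adjoin ℂ Z) := Algebra.adjoinCommRingOfComm ℂ hZ
  let φ : (Algebra.adjoin ℂ Z) →+* (H →L[ℂ] H) :=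
    { toFun := fun z => z.1
      map_one' := rfl
      map_mul' := fun _ _ => rfl
      map_zero' := rfl
      map_add' := fun _ _ => rfl }
  have hTZ : ∀ t i j, v i * x t * star (v j) ∈ Z := by
    intro t i j
    refine ⟨mul_mem (mul_mem (hc.vmem i) (hx t)) (star_mem (hc.vmem j)), ?_, ?_⟩
    · simp only [← mul_assoc, hc.ev]
    · simp only [mul_assoc, hve]
  let X : Fin k → Matrix (Fin m) (Fin m) (Algebra.adjoin ℂ Z) := fun t i j =>
    ⟨v i * x t * star (v j), Algebra.subset_adjoin (hTZ t i j)⟩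
  have hvy : ∀ i, v i * y = 0 := by
    refine std_abs φ (lt_of_le_of_lt (Nat.mul_le_mul hmN hmN) hk) v x X ?_
    intro t i
    exact hexp (v i * x t) (mul_mem (hc.vmem i) (hx t)) (by rw [← mul_assoc, hc.ev])
  have hey : e * y = 0 := by
    rw [hexp e hc.mem hc.idem, Finset.sum_mul]
    refine Finset.sum_eq_zero fun j _ => ?_
    rw [mul_assoc, hvy, mul_zero]
  apply hc.ne
  have hep : e * p = e := by
    have := congrArg star hpe
    rwa [star_mul, hps, hc.sa] at this
  rw [← hep, ← h2, ← mul_assoc, ← mul_assoc e y, hey]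
  simp

end VN

section Khinchin

def bsg (c : Bool) : ℂ := cond c 1 (-1)

theorem bsg_norm (c : Bool) : ‖bsg c‖ = 1 := by cases c <;> simp [bsg]

theorem sum_bool_succ {R : Type*} [AddCommMonoid R] (n : ℕ) (F : (Fin (n+1) → Bool) → R) :
    ∑ ε, F ε = ∑ ε : Fin n → Bool, (F (Fin.cons true ε) + F (Fin.cons false ε)) := by
  rw [← (Fin.consEquiv (fun _ => Bool)).sum_comp, Fintype.sum_prod_type, Finset.sum_comm]
  refine Finset.sum_congr rfl fun ε _ => ?_
  rw [Fintype.sum_bool]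
  rfl

theorem par2 (x y : ℂ) : ‖x + y‖^2 + ‖y - x‖^2 = 2 * (‖x‖^2 + ‖y‖^2) := by
  simp only [Complex.sq_norm, Complex.normSq_apply, Complex.add_re, Complex.add_im, Complex.sub_re,
    Complex.sub_im]
  ring

theorem par4 (x y : ℂ) : ‖x + y‖^4 + ‖y - x‖^4 ≤ 2 * (‖x‖^4 + 6 * ‖x‖^2*‖y‖^2 + ‖y‖^4) := by
  have e : ∀ z : ℂ, ‖z‖^4 = (‖z‖^2)^2 := fun z => by ring
  simp only [e, Complex.sq_norm, Complex.normSq_apply, Complex.add_re, Complex.add_im,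
    Complex.sub_re, Complex.sub_im]
  nlinarith [sq_nonneg (x.re * y.im - x.im * y.re)]

theorem second_moment : ∀ (n : ℕ) (b : Fin n → ℂ),
    ∑ ε : Fin n → Bool, ‖∑ i, bsg (ε i) * b i‖^2 = 2^n * ∑ i, ‖b i‖^2 := by
  intro n
  induction n with
  | zero => intro b; simp
  | succ n ih =>
    intro b
    rw [sum_bool_succ]
    simp only [Fin.sum_univ_succ, Fin.cons_zero, Fin.cons_succ]
    have : ∀ ε : Fin n → Bool, ‖bsg true * b 0 + ∑ i : Fin n, bsg (ε i) * b i.succ‖^2 +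
      ‖bsg false * b 0 + ∑ i : Fin n, bsg (ε i) * b i.succ‖^2 =
        2 * (‖b 0‖^2 + ‖∑ i : Fin n, bsg (ε i) * b i.succ‖^2) := by
      intro ε
      rw [← par2]; congr 3 <;> simp [bsg] <;> ring
    simp only [this]
    rw [← Finset.mul_sum, Finset.sum_add_distrib, ih (fun i => b i.succ)]
    simp
    ring

theorem fourth_moment : ∀ (n : ℕ) (b : Fin n → ℂ),
    ∑ ε : Fin n → Bool, ‖∑ i, bsg (ε i) * b i‖^4 ≤ 2^n * (3 * (∑ i, ‖b i‖^2)^2) := by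
  intro n
  induction n with
  | zero => intro b; simp
  | succ n ih =>
    intro b
    rw [sum_bool_succ]
    simp only [Fin.sum_univ_succ, Fin.cons_zero, Fin.cons_succ]
    have : ∀ ε : Fin n → Bool, ‖bsg true * b 0 + ∑ i : Fin n, bsg (ε i) * b i.succ‖^4 +
      ‖bsg false * b 0 + ∑ i : Fin n, bsg (ε i) * b i.succ‖^4 ≤
        2 * (‖b 0‖^4 + 6 * ‖b 0‖^2 * ‖∑ i : Fin n, bsg (ε i) * b i.succ‖^2
          + ‖∑ i : Fin n, bsg (ε i) * b i.succ‖^4) := by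
      intro ε
      refine le_trans (le_of_eq ?_) (par4 _ _)
      congr 3 <;> simp [bsg] <;> ring
    refine (Finset.sum_le_sum fun ε _ => this ε).trans ?_
    rw [← Finset.mul_sum, Finset.sum_add_distrib, Finset.sum_add_distrib, ← Finset.mul_sum,
      second_moment n (fun i => b i.succ)]
    have := ih (fun i => b i.succ)
    simp only [Finset.sum_const, Finset.card_univ, Fintype.card_fun, Fintype.card_bool,
      Fintype.card_fin, nsmul_eq_mul, Nat.cast_pow, Nat.cast_ofNat]
    have h2 : (0:ℝ) < 2^n := by positivity
    have h3 : 0 ≤ ‖b 0‖^4 := by positivity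
    rw [pow_succ (2:ℝ) n]
    nlinarith [mul_nonneg h2.le h3]

theorem khinchin (n : ℕ) (b : Fin n → ℂ) :
    2^n * √(∑ i, ‖b i‖^2) ≤ √3 * ∑ ε : Fin n → Bool, ‖∑ i, bsg (ε i) * b i‖ := by
  have hS0 : 0 ≤ ∑ i, ‖b i‖^2 := Finset.sum_nonneg fun _ _ => by positivity
  set s := √(∑ i, ‖b i‖^2) with hs
  have hss : s^2 = ∑ i, ‖b i‖^2 := Real.sq_sqrt hS0
  rcases (Real.sqrt_nonneg (∑ i, ‖b i‖^2)).eq_or_lt with h0 | hpos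
  · rw [hs, ← h0, mul_zero]; positivity
  rw [← hs] at hpos
  have h3 : √3 ^ 2 = 3 := Real.sq_sqrt (by norm_num)
  have h3p : 0 < √3 := by positivity
  set r := √3 * s with hr
  have hrp : 0 < r := by positivity
  have hpt : ∀ t : ℝ, 0 ≤ t → (3 * r^2 * t^2 - t^4) ≤ 2 * r^3 * t := by
    intro t ht
    have : 0 ≤ t * ((t - r)^2 * (t + 2 * r)) := by positivity
    nlinarith
  have hsum := Finset.sum_le_sum fun (ε : Fin n → Bool) (_ : ε ∈ Finset.univ) =>
    hpt ‖∑ i, bsg (ε i) * b i‖ (norm_nonneg _)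
  rw [Finset.sum_sub_distrib, ← Finset.mul_sum, ← Finset.mul_sum, second_moment] at hsum
  have h4 := fourth_moment n b
  rw [← hss] at hsum h4
  set Y := ∑ ε : Fin n → Bool, ‖∑ i, bsg (ε i) * b i‖
  have hr2 : r^2 = 3 * s^2 := by rw [hr, mul_pow, h3]
  have hr3 : r^3 = 3 * s^3 * √3 := by
    have : r^3 = r^2 * r := by ring
    rw [this, hr2, hr]; ring
  rw [hr2, hr3] at hsum
  have h5 : (6 * s^3) * (2^n * s) ≤ (6 * s^3) * (√3 * Y) := by nlinarith
  exact le_of_mul_le_mul_left h5 (by positivity)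

theorem factor_bound {N m : ℕ} (A B : Fin N → Fin m → ℂ) {α β : ℝ} (hα : 0 ≤ α) (hβ : 0 ≤ β)
    (hA : ∀ j, ∑ i, ‖A i j‖^2 ≤ α^2)
    (hB : ∀ y : Fin m → ℂ, (∀ j, ‖y j‖ ≤ 1) → ∑ i, ‖∑ j, y j * B i j‖^2 ≤ β^2)
    (hAB : ∀ i, ∑ j, A i j * B i j = 1) : (N : ℝ) ≤ 3 * α^2 * β^2 := by
  have h1 : (N : ℝ) ≤ ∑ j, α * √(∑ i, ‖B i j‖^2) := by
    have : (N : ℂ) = ∑ j, ∑ i, A i j * B i j := by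
      rw [Finset.sum_comm]; simp [hAB]
    have h : (N : ℝ) = ‖∑ j, ∑ i, A i j * B i j‖ := by rw [← this]; simp
    rw [h]
    refine (norm_sum_le _ _).trans (Finset.sum_le_sum fun j _ => ?_)
    refine (norm_sum_le _ _).trans ?_
    simp only [norm_mul]
    refine (Real.sum_mul_le_sqrt_mul_sqrt _ _ _).trans ?_
    gcongr
    rw [← Real.sqrt_sq hα]
    exact Real.sqrt_le_sqrt (hA j)
  have h2 : ∀ ε : Fin N → Bool, ∑ j, ‖∑ i, bsg (ε i) * B i j‖ ≤ √N * β := by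
    intro ε
    have : ∀ j, ∃ θ : ℂ, ‖θ‖ ≤ 1 ∧
        θ * (∑ i, bsg (ε i) * B i j) = (‖∑ i, bsg (ε i) * B i j‖ : ℂ) := by
      intro j
      set X := ∑ i, bsg (ε i) * B i j
      by_cases hX : X = 0
      · exact ⟨0, by simp, by simp [hX]⟩
      · have hn : (‖X‖ : ℂ) ≠ 0 := by simpa using hX
        refine ⟨(starRingEnd ℂ) X / ‖X‖, ?_, ?_⟩
        · simp [hX]
        · rw [div_mul_eq_mul_div, mul_comm, Complex.mul_conj, Complex.normSq_eq_norm_sq]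
          push_cast
          field_simp
    choose θ hθ1 hθ using this
    have e : ((∑ j, ‖∑ i, bsg (ε i) * B i j‖ : ℝ) : ℂ) = ∑ i, bsg (ε i) * ∑ j, θ j * B i j := by
      push_cast
      simp only [← hθ, Finset.mul_sum]
      rw [Finset.sum_comm]
      refine Finset.sum_congr rfl fun i _ => Finset.sum_congr rfl fun j _ => by ring
    have e2 : (∑ j, ‖∑ i, bsg (ε i) * B i j‖ : ℝ) = ‖∑ i, bsg (ε i) * ∑ j, θ j * B i j‖ := by
      rw [← e, Complex.norm_real, Real.norm_of_nonneg (Finset.sum_nonneg fun _ _ => norm_nonneg _)]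
    rw [e2]
    refine (norm_sum_le _ _).trans ?_
    simp only [norm_mul]
    refine (Real.sum_mul_le_sqrt_mul_sqrt _ _ _).trans ?_
    simp only [bsg_norm]
    have := Real.sqrt_le_sqrt (hB θ hθ1)
    rw [Real.sqrt_sq hβ] at this
    simp only [one_pow, Finset.sum_const, Finset.card_univ, Fintype.card_fin, nsmul_eq_mul, mul_one]
    gcongr
  have h3 : 2^N * ∑ j, √(∑ i, ‖B i j‖^2) ≤ √3 * (2^N * (√N * β)) := by
    rw [Finset.mul_sum]
    refine (Finset.sum_le_sum fun j _ => khinchin N (fun i => B i j)).trans ?_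
    rw [← Finset.mul_sum, Finset.sum_comm]
    gcongr
    refine (Finset.sum_le_sum fun ε _ => h2 ε).trans ?_
    simp
  have h4 : ∑ j, √(∑ i, ‖B i j‖^2) ≤ √3 * (√N * β) := by
    have h2p : (0:ℝ) < 2^N := by positivity
    refine le_of_mul_le_mul_left ?_ h2p
    linarith
  rw [← Finset.mul_sum] at h1
  have h5 : (N : ℝ) ≤ α * (√3 * (√N * β)) := h1.trans (by gcongr)
  have hN : √(N:ℝ)^2 = N := Real.sq_sqrt (by positivity)
  rcases (Real.sqrt_nonneg (N:ℝ)).eq_or_lt with h0 | hp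
  · have hz : (N:ℝ) = 0 := by rw [← hN, ← h0]; simp
    rw [hz]; positivity
  have h6 : √(N:ℝ) ≤ √3 * α * β := by
    refine le_of_mul_le_mul_left ?_ hp
    nlinarith
  calc (N:ℝ) = √(N:ℝ)^2 := hN.symm
    _ ≤ (√3 * α * β)^2 := by gcongr
    _ = 3 * α^2 * β^2 := by rw [mul_pow, mul_pow, Real.sq_sqrt (by norm_num)]

end Khinchin

theorem chain_bound {H : Type} [NormedAddCommGroup H] [InnerProductSpace ℂ H] [CompleteSpace H]
    (M : VonNeumannAlgebra H)
    (ℓ : M.toSubalgebra →L[ℂ] (H →L[ℂ] H))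
    (hℓ : ∀ x : M.toSubalgebra, ℓ x = (x : H →L[ℂ] H))
    (lam : ℝ) (E : Type) [NormedAddCommGroup E] [NormedSpace ℂ E] (hE : IsLinftySpace E lam)
    (S : M.toSubalgebra →L[ℂ] E) (T : E →L[ℂ] (H →L[ℂ] H)) (hTS : T.comp S = ℓ)
    {N : ℕ} {e : H →L[ℂ] H} {v : Fin N → (H →L[ℂ] H)} (hc : IsVNChain M e v) :
    (N : ℝ) ≤ 3 * (‖S‖ * ‖T‖ * lam)^2 := by
  obtain ⟨ξ, hξ1, heξ⟩ : ∃ ξ : H, ‖ξ‖ = 1 ∧ e ξ = ξ := by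
    obtain ⟨η, hη⟩ : ∃ η, e η ≠ 0 := by
      by_contra hcon
      push Not at hcon
      exact hc.ne (ContinuousLinearMap.ext hcon)
    have hee : e (e η) = e η := congrArg (fun z : H →L[ℂ] H => z η) hc.idem
    refine ⟨((‖e η‖⁻¹ : ℝ) : ℂ) • e η, ?_, ?_⟩
    · rw [norm_smul]
      have := norm_ne_zero_iff.2 hη
      simp [this]
    · rw [map_smul, hee]
  have hinner : ∀ i j, inner ℂ ((star (v i)) ξ) ((star (v j)) ξ) = if i = j then (1:ℂ) else 0 := by
    intro i j
    rw [ContinuousLinearMap.star_eq_adjoint, ContinuousLinearMap.adjoint_inner_left]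
    have : v i (star (v j) ξ) = (v i * star (v j)) ξ := rfl
    rw [this, hc.orth]
    split_ifs
    · rw [heξ, inner_self_eq_norm_sq_to_K, hξ1]; simp
    · simp
  have horth : Orthonormal ℂ (fun i => (star (v i)) ξ) := by
    rw [orthonormal_iff_ite]; exact hinner
  let xs : Fin N → M.toSubalgebra := fun i => ⟨star (v i), star_mem (s := M) (hc.vmem i)⟩
  have hTSx : ∀ i, T (S (xs i)) = star (v i) := by
    intro i
    have := congrArg (fun f => f (xs i)) hTS
    simp only [ContinuousLinearMap.comp_apply, hℓ] at this
    exact this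
  have hnorm : ∀ c : Fin N → ℂ, ‖∑ i, c i • xs i‖^2 ≤ ∑ i, ‖c i‖^2 := by
    intro c
    have e0 : ((∑ i, c i • xs i : M.toSubalgebra) : H →L[ℂ] H) = ∑ i, c i • star (v i) := by
      rw [AddSubmonoidClass.coe_finsetSum]
      rfl
    have e1 : ‖∑ i, c i • xs i‖ = ‖∑ i, c i • star (v i)‖ := by
      rw [← e0]
      rfl
    rw [e1, sq, ← CStarRing.norm_star_mul_self]
    have e2 : star (∑ i, c i • star (v i)) * (∑ i, c i • star (v i))
        = ((∑ i, ‖c i‖^2 : ℝ) : ℂ) • e := by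
      simp only [star_sum, star_smul, star_star, Finset.sum_mul_sum, smul_mul_assoc, mul_smul_comm,
        hc.orth, smul_ite, smul_zero, Finset.sum_ite_eq, Finset.mem_univ, if_true, smul_smul]
      rw [← Finset.sum_smul]
      congr 1
      push_cast
      refine Finset.sum_congr rfl fun i _ => ?_
      exact Complex.mul_conj' (c i)
    rw [e2, norm_smul, proj_norm_one hc.sa hc.idem hc.ne, mul_one, Complex.norm_real,
      Real.norm_of_nonneg (Finset.sum_nonneg fun _ _ => by positivity)]
  obtain ⟨G, hFG, hGfin, τ, hτ⟩ := hE.2 (Submodule.span ℂ (Set.range fun i => S (xs i)))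
    (FiniteDimensional.span_of_finite ℂ (Set.finite_range _))
  let g : Fin N → G := fun i => ⟨S (xs i), hFG (Submodule.subset_span ⟨i, rfl⟩)⟩
  set t1 := ‖(τ : G →L[ℂ] (Fin (Module.finrank ℂ G) → ℂ))‖ with ht1
  set t2 := ‖(τ.symm : (Fin (Module.finrank ℂ G) → ℂ) →L[ℂ] G)‖ with ht2
  have ht10 : 0 ≤ t1 := ContinuousLinearMap.opNorm_nonneg _
  have ht20 : 0 ≤ t2 := ContinuousLinearMap.opNorm_nonneg _
  let L : (Fin (Module.finrank ℂ G) → ℂ) → Fin N → ℂ := fun y i =>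
    inner ℂ ((star (v i)) ξ) (T (τ.symm y : E) ξ)
  have hL : ∀ y i, ∑ j, y j * L (Pi.single j 1) i = L y i := by
    intro y i
    have hy : y = ∑ j, y j • (Pi.single j (1:ℂ) : Fin (Module.finrank ℂ G) → ℂ) := by
      funext l
      simp [Finset.sum_apply, Pi.single_apply]
    conv_rhs => rw [hy]
    simp only [L, map_sum, map_smul, Submodule.coe_sum, Submodule.coe_smul,
      ContinuousLinearMap.sum_apply, ContinuousLinearMap.smul_apply, inner_sum, inner_smul_right]
  have hmain := factor_bound (fun i j => τ (g i) j) (fun i j => L (Pi.single j 1) i)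
    (α := t1 * ‖S‖) (β := ‖T‖ * t2) (by positivity) (by positivity) ?_ ?_ ?_
  · refine hmain.trans ?_
    have : 3 * (t1 * ‖S‖)^2 * (‖T‖ * t2)^2 = 3 * (‖S‖ * ‖T‖ * (t1 * t2))^2 := by ring
    rw [this]
    gcongr
  · intro j
    set s := ∑ i, ‖τ (g i) j‖^2 with hs
    have hs0 : 0 ≤ s := Finset.sum_nonneg fun _ _ => by positivity
    let c : Fin N → ℂ := fun i => (starRingEnd ℂ) (τ (g i) j)
    have h1 : (s : ℂ) = τ (∑ i, c i • g i) j := by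
      simp only [map_sum, map_smul, Finset.sum_apply, Pi.smul_apply, smul_eq_mul, c]
      rw [hs]; push_cast
      refine Finset.sum_congr rfl fun i _ => ?_
      exact (Complex.conj_mul' _).symm
    have h2 : s ≤ t1 * ‖∑ i, c i • g i‖ := by
      have : s = ‖τ (∑ i, c i • g i) j‖ := by
        rw [← h1, Complex.norm_real, Real.norm_of_nonneg hs0]
      rw [this]
      refine (norm_le_pi_norm _ j).trans ?_
      exact (τ : G →L[ℂ] (Fin (Module.finrank ℂ G) → ℂ)).le_opNorm _
    have h3 : ‖∑ i, c i • g i‖ ≤ ‖S‖ * ‖∑ i, c i • xs i‖ := by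
      have : ‖∑ i, c i • g i‖ = ‖S (∑ i, c i • xs i)‖ := by
        rw [← Submodule.norm_coe]
        simp only [Submodule.coe_sum, Submodule.coe_smul, map_sum, map_smul, g]
      rw [this]
      exact S.le_opNorm _
    have h4 := hnorm c
    have h5 : ∑ i, ‖c i‖^2 = s := by simp [c, hs]
    rw [h5] at h4
    have h6 : s ≤ t1 * ‖S‖ * ‖∑ i, c i • xs i‖ := by
      refine h2.trans ?_
      rw [mul_assoc]; gcongr
    have h7 : s^2 ≤ (t1 * ‖S‖)^2 * s := by
      calc s^2 ≤ (t1 * ‖S‖ * ‖∑ i, c i • xs i‖)^2 := by gcongr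
        _ = (t1 * ‖S‖)^2 * ‖∑ i, c i • xs i‖^2 := by ring
        _ ≤ _ := by gcongr
    rcases hs0.eq_or_lt with h0 | hp
    · rw [← h0]; positivity
    · refine le_of_mul_le_mul_right ?_ hp
      linarith
  · intro y hy
    simp only [hL]
    refine (horth.sum_inner_products_le (x := T (τ.symm y : E) ξ) (s := Finset.univ)).trans ?_
    have hy1 : ‖y‖ ≤ 1 := (pi_norm_le_iff_of_nonneg zero_le_one).2 hy
    have : ‖T (τ.symm y : E) ξ‖ ≤ ‖T‖ * t2 := by
      calc ‖T (τ.symm y : E) ξ‖ ≤ ‖T (τ.symm y : E)‖ * ‖ξ‖ := ContinuousLinearMap.le_opNorm _ _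
        _ = ‖T (τ.symm y : E)‖ := by rw [hξ1, mul_one]
        _ ≤ ‖T‖ * ‖τ.symm y‖ := T.le_opNorm _
        _ ≤ ‖T‖ * (t2 * ‖y‖) := by
          gcongr
          exact (τ.symm : (Fin (Module.finrank ℂ G) → ℂ) →L[ℂ] G).le_opNorm y
        _ ≤ ‖T‖ * (t2 * 1) := by gcongr
        _ = ‖T‖ * t2 := by rw [mul_one]
    gcongr
  · intro i
    rw [hL]
    simp only [L, ContinuousLinearEquiv.symm_apply_apply, g, hTSx]
    rw [hinner, if_pos rfl]

theorem stmt_2 {H : Type} [NormedAddCommGroup H] [InnerProductSpace ℂ H] [CompleteSpace H]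
    [TopologicalSpace.SeparableSpace H] (M : VonNeumannAlgebra H)
    (ℓ : M.toSubalgebra →L[ℂ] (H →L[ℂ] H))
    (hℓ : ∀ x : M.toSubalgebra, ℓ x = (x : H →L[ℂ] H))
    (lam : ℝ) (hlam : 1 ≤ lam) (h : HasLPProperty lam ℓ) :
    ∃ n : ℕ, 0 < n ∧
      ∀ x : Fin (2 * n) → M.toSubalgebra,
        ∑ σ : Equiv.Perm (Fin (2 * n)),
          (Equiv.Perm.sign σ : ℤ) • (List.ofFn fun i => x (σ i)).prod = 0 := by
  obtain ⟨E, _, _, hE, S, T, hTS⟩ := h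
  obtain ⟨N, hNlt⟩ := exists_nat_gt (3 * (‖S‖ * ‖T‖ * lam)^2)
  have hno : ∀ (e : H →L[ℂ] H) (v : Fin (N+1) → (H →L[ℂ] H)), ¬ IsVNChain M e v := by
    intro e v hc
    have hb := chain_bound M ℓ hℓ lam E hE S T hTS hc
    push_cast at hb
    linarith
  refine ⟨(N+1) * (N+1) + 1, by positivity, fun x => ?_⟩
  have := vn_pi M (k := 2 * ((N+1) * (N+1) + 1)) (Nat.le_add_left 1 N) hno (by nlinarith)
    (fun i => (x i : H →L[ℂ] H)) (fun i => (x i).2)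
  apply Subtype.ext
  rw [AddSubmonoidClass.coe_finset_sum]
  refine Eq.trans (Finset.sum_congr rfl fun σ _ => ?_) this
  have hp : (((List.ofFn fun i => x (σ i)).prod : M.toSubalgebra) : H →L[ℂ] H)
      = (List.ofFn fun i => (x (σ i) : H →L[ℂ] H)).prod := by
    rw [SubmonoidClass.coe_list_prod, List.map_ofFn]
    rfl
  rw [← hp]
  rfl
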